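/- arXiv:math/0701250 — 2 statements merged into one kernel-verified Lean document; each statement's English description precedes it below -/
import Mathlib

section
/- Let D ≥ 2 and N ≥ 1 be integers and x ≥ D. Then Dkhi(D,N,x) ≤ (1 + 2x/(ND)) · P(F_{D,N+2} ≥ (N+2)x/(ND)), where Dkhi(D,N,x) = E[(X_D - x X_N/N)₊]/D with X_D ~ χ²(D), X_N ~ χ²(N) independent, and F_{D,N+2} is a Fisher random variable with D and N+2 degrees of freedom. -/
open MeasureTheory ProbabilityTheory Real

/-- The (unnormalised) beta-prime density. -/
noncomputable def bpK (a b u : ℝ) : ℝ := u ^ (a - 1) * (1 + u) ^ (-(a + b + 1))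

lemma bpK_nonneg {a b u : ℝ} (hu : 0 < u) : 0 ≤ bpK a b u := by
  unfold bpK; positivity

lemma bpK_deriv1 {a b u : ℝ} (hu : 0 < u) :
    HasDerivAt (fun u : ℝ => -(u ^ a * (1 + u) ^ (-(a + b)))) ((b * u - a) * bpK a b u) u := by
  have h1 : HasDerivAt (fun u : ℝ => u ^ a) (a * u ^ (a - 1)) u :=
    Real.hasDerivAt_rpow_const (Or.inl hu.ne')
  have h0 : HasDerivAt (fun u : ℝ => 1 + u) 1 u := (hasDerivAt_id u).const_add 1
  have h2 := h0.rpow_const (p := -(a + b)) (Or.inl (by positivity : (1 + u) ≠ 0))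
  have h3 := (h1.mul h2).neg
  refine HasDerivAt.congr_deriv h3 ?_
  have e1 : u ^ a = u ^ (a - 1) * u := by
    rw [← Real.rpow_add_one hu.ne']; ring_nf
  have hp : (1 + u) ≠ 0 := by positivity
  have e2 : (1 + u) ^ (-(a + b)) = (1 + u) ^ (-(a + b + 1)) * (1 + u) := by
    rw [← Real.rpow_add_one hp]; ring_nf
  have e3 : (1 + u) ^ (-(a + b) - 1) = (1 + u) ^ (-(a + b + 1)) := by ring_nf
  rw [e3, e1, e2]; unfold bpK; ring

lemma bpK_deriv2 {a b u : ℝ} (hu : 0 < u) :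
    HasDerivAt (fun u : ℝ => -(u ^ (a - 1) * (1 + u) ^ (-(a + b))))
      ((b + 1 - (a - 1) / u) * bpK a b u) u := by
  have h1 : HasDerivAt (fun u : ℝ => u ^ (a - 1)) ((a - 1) * u ^ (a - 1 - 1)) u :=
    Real.hasDerivAt_rpow_const (Or.inl hu.ne')
  have h0 : HasDerivAt (fun u : ℝ => 1 + u) 1 u := (hasDerivAt_id u).const_add 1
  have h2 := h0.rpow_const (p := -(a + b)) (Or.inl (by positivity : (1 + u) ≠ 0))
  have h3 := (h1.mul h2).neg
  refine HasDerivAt.congr_deriv h3 ?_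
  have e1 : u ^ (a - 1) = u ^ (a - 1 - 1) * u := by
    rw [← Real.rpow_add_one hu.ne']; ring_nf
  have hp : (1 + u) ≠ 0 := by positivity
  have e2 : (1 + u) ^ (-(a + b)) = (1 + u) ^ (-(a + b + 1)) * (1 + u) := by
    rw [← Real.rpow_add_one hp]; ring_nf
  have e3 : (1 + u) ^ (-(a + b) - 1) = (1 + u) ^ (-(a + b + 1)) := by ring_nf
  unfold bpK
  rw [e3, e1, e2]; field_simp; ring

lemma bpK_le {a b u : ℝ} (hu : 0 < u) (ha : 0 < a) (hb : 0 < b) :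
    bpK a b u ≤ u ^ (-b - 2) := by
  unfold bpK
  have : (1 + u) ^ (-(a + b + 1)) ≤ u ^ (-(a + b + 1)) :=
    Real.rpow_le_rpow_of_nonpos hu (by linarith) (by linarith)
  calc _ ≤ u ^ (a - 1) * u ^ (-(a + b + 1)) := by gcongr
    _ = _ := by rw [← Real.rpow_add hu]; ring_nf

lemma bp_tendsto {a b : ℝ} (p : ℝ) (hp : p ≤ a) (ha : 0 < a) (hb : 0 < b) :
    Filter.Tendsto (fun u : ℝ => -(u ^ p * (1 + u) ^ (-(a + b)))) Filter.atTop (nhds 0) := by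
  rw [← neg_zero]
  apply Filter.Tendsto.neg
  apply squeeze_zero' (g := fun u : ℝ => u ^ (-b))
  · filter_upwards [Filter.eventually_gt_atTop 0] with u hu
    positivity
  · filter_upwards [Filter.eventually_gt_atTop 1] with u hu
    have h0 : 0 < u := by linarith
    have : (1 + u) ^ (-(a + b)) ≤ u ^ (-(a + b)) :=
      Real.rpow_le_rpow_of_nonpos h0 (by linarith) (by linarith)
    have h2 : u ^ p ≤ u ^ a := Real.rpow_le_rpow_of_exponent_le hu.le hp
    calc _ ≤ u ^ a * u ^ (-(a + b)) := by gcongr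
      _ = _ := by rw [← Real.rpow_add h0]; ring_nf
  · exact tendsto_rpow_neg_atTop hb

lemma bpK_meas (a b : ℝ) : Measurable (bpK a b) := by
  unfold bpK; fun_prop

lemma bpK_int {a b c : ℝ} (ha : 0 < a) (hb : 0 < b) (hc : 0 < c) :
    IntegrableOn (bpK a b) (Set.Ioi c) := by
  refine Integrable.mono' (integrableOn_Ioi_rpow_of_lt (a := -b - 2) (by linarith) hc)
    (bpK_meas a b).aestronglyMeasurable ?_
  filter_upwards [ae_restrict_mem measurableSet_Ioi] with u hu
  have hu0 : 0 < u := hc.trans hu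
  rw [Real.norm_of_nonneg (bpK_nonneg hu0)]
  exact bpK_le hu0 ha hb

lemma bp_main {a b c : ℝ} (ha : 1 ≤ a) (hb : 0 < b) (hc : a / b ≤ c) :
    IntegrableOn (fun u => (u - c) * bpK a b u) (Set.Ioi c) ∧
    b * ∫ u in Set.Ioi c, (u - c) * bpK a b u ≤ (a + c) * ∫ u in Set.Ioi c, bpK a b u := by
  have ha0 : 0 < a := by linarith
  have hc0 : 0 < c := lt_of_lt_of_le (by positivity) hc
  have hac : a ≤ c * b := (div_le_iff₀ hb).1 hc
  have d1 : ∀ u ∈ Set.Ici c, HasDerivAt (fun u : ℝ => -(u ^ a * (1 + u) ^ (-(a + b))))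
      ((b * u - a) * bpK a b u) u := fun u hu => bpK_deriv1 (hc0.trans_le hu)
  have d2 : ∀ u ∈ Set.Ici c, HasDerivAt (fun u : ℝ => -(u ^ (a - 1) * (1 + u) ^ (-(a + b))))
      ((b + 1 - (a - 1) / u) * bpK a b u) u := fun u hu => bpK_deriv2 (hc0.trans_le hu)
  have n1 : ∀ u ∈ Set.Ioi c, 0 ≤ (b * u - a) * bpK a b u := by
    intro u hu
    have hu : c < u := hu
    refine mul_nonneg ?_ (bpK_nonneg (hc0.trans hu))
    nlinarith
  have n2 : ∀ u ∈ Set.Ioi c, 0 ≤ (b + 1 - (a - 1) / u) * bpK a b u := by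
    intro u hu
    have hu : c < u := hu
    have hu0 := hc0.trans hu
    refine mul_nonneg ?_ (bpK_nonneg hu0)
    rw [sub_nonneg, div_le_iff₀ hu0]
    nlinarith
  have i1 := integrableOn_Ioi_deriv_of_nonneg' d1 n1 (bp_tendsto a le_rfl ha0 hb)
  have i2 := integrableOn_Ioi_deriv_of_nonneg' d2 n2 (bp_tendsto (a - 1) (by linarith) ha0 hb)
  have v1 := integral_Ioi_of_hasDerivAt_of_nonneg' d1 n1 (bp_tendsto a le_rfl ha0 hb)
  have v2 := integral_Ioi_of_hasDerivAt_of_nonneg' d2 n2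
    (bp_tendsto (a - 1) (by linarith) ha0 hb)
  have iK := bpK_int ha0 hb hc0
  have hfun : (fun u => (u - c) * bpK a b u) =
      fun u => b⁻¹ * ((b * u - a) * bpK a b u) + (a / b - c) * bpK a b u := by
    funext u; field_simp; ring
  have I1 : Integrable (fun u => b⁻¹ * ((b * u - a) * bpK a b u))
    (volume.restrict (Set.Ioi c)) := i1.const_mul _
  have I2 : Integrable (fun u => (a / b - c) * bpK a b u)
    (volume.restrict (Set.Ioi c)) := iK.const_mul _
  have h2 : ∫ u in Set.Ioi c, (b + 1 - (a - 1) / u) * bpK a b u ≤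
      ∫ u in Set.Ioi c, (b + 1) * bpK a b u := by
    refine setIntegral_mono_on i2 (iK.const_mul _) measurableSet_Ioi fun u hu => ?_
    have hu0 : 0 < u := hc0.trans hu
    refine mul_le_mul_of_nonneg_right ?_ (bpK_nonneg hu0)
    have : 0 ≤ (a - 1) / u := div_nonneg (by linarith) hu0.le
    linarith
  refine ⟨by rw [hfun]; exact I1.add I2, ?_⟩
  rw [hfun, integral_add I1 I2, integral_const_mul, integral_const_mul, v1]
  rw [v2, integral_const_mul] at h2
  have e1 : c ^ a = c ^ (a - 1) * c := by
    rw [← Real.rpow_add_one hc0.ne']; ring_nf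
  rw [e1]
  set J := ∫ u in Set.Ioi c, bpK a b u
  have h3 := mul_le_mul_of_nonneg_left h2 hc0.le
  field_simp
  nlinarith

lemma measurable_gammaPDF' (a r : ℝ) : Measurable (gammaPDF a r) :=
  (measurable_gammaPDFReal a r).ennreal_ofReal

lemma lintegral_scale (f : ℝ → ENNReal) (hf : Measurable f) {y : ℝ} (hy : 0 < y) :
    ∫⁻ x, f x = ENNReal.ofReal y * ∫⁻ u, f (u * y) := by
  conv_lhs => rw [← Real.smul_map_volume_mul_right hy.ne']
  rw [lintegral_smul_measure, lintegral_map hf (by fun_prop), abs_of_pos hy, smul_eq_mul]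

/-- Normalising constant of the beta-prime density. -/
noncomputable def bpC (a b : ℝ) : ℝ := Gamma (a + b + 1) / (Gamma a * Gamma (b + 1))

lemma bpC_pos {a b : ℝ} (ha : 0 < a) (hb : 0 < b) : 0 < bpC a b := by
  unfold bpC
  have := Gamma_pos_of_pos ha
  have := Gamma_pos_of_pos (show 0 < b + 1 by linarith)
  have := Gamma_pos_of_pos (show 0 < a + b + 1 by linarith)
  positivity

lemma bp_inner {a b u : ℝ} (ha : 0 < a) (hb : 0 < b) (hu : 0 < u) :
    ∫⁻ y, gammaPDF (b + 1) (1 / 2) y * (ENNReal.ofReal y * gammaPDF a (1 / 2) (u * y)) =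
      ENNReal.ofReal (bpC a b * bpK a b u) := by
  have key : ∀ y : ℝ, y ≠ 0 →
      gammaPDF (b + 1) (1 / 2) y * (ENNReal.ofReal y * gammaPDF a (1 / 2) (u * y)) =
      ENNReal.ofReal (bpC a b * bpK a b u) * gammaPDF (a + b + 1) ((1 + u) / 2) y := by
    intro y hy
    rcases lt_or_gt_of_ne hy with hy | hy
    · simp [gammaPDF_of_neg hy]
    have g1 := Gamma_pos_of_pos ha
    have g2 := Gamma_pos_of_pos (show 0 < b + 1 by linarith)
    have g3 := Gamma_pos_of_pos (show 0 < a + b + 1 by linarith)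
    have hC := bpC_pos ha hb
    have hK : 0 ≤ bpK a b u := bpK_nonneg hu
    rw [gammaPDF_of_nonneg hy.le, gammaPDF_of_nonneg hy.le,
      gammaPDF_of_nonneg (by positivity), ← ENNReal.ofReal_mul (by positivity),
      ← ENNReal.ofReal_mul (by positivity), ← ENNReal.ofReal_mul (by positivity)]
    congr 1
    have x1 : exp (-((1 + u) / 2 * y)) = exp (-(1 / 2 * y)) * exp (-(1 / 2 * (u * y))) := by
      rw [← Real.exp_add]; ring_nf
    have x2 : (u * y) ^ (a - 1) = u ^ (a - 1) * y ^ (a - 1) := Real.mul_rpow hu.le hy.le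
    have x3 : y ^ (a + b + 1 - 1) = y ^ (b + 1 - 1) * y * y ^ (a - 1) := by
      rw [← Real.rpow_add_one hy.ne', ← Real.rpow_add hy]; ring_nf
    have x4 : ((1 + u) / 2) ^ (a + b + 1) = (1 + u) ^ (a + b + 1) *
        ((1 / 2) ^ (b + 1) * (1 / 2) ^ a) := by
      rw [← Real.rpow_add (by norm_num), div_eq_mul_one_div,
        Real.mul_rpow (by positivity) (by norm_num)]
      ring_nf
    have x5 : (1 + u) ^ (-(a + b + 1)) * (1 + u) ^ (a + b + 1) = 1 := by
      rw [← Real.rpow_add (by positivity), neg_add_cancel, Real.rpow_zero]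
    rw [x1, x2, x3, x4]
    unfold bpC bpK
    generalize (1 + u) ^ (-(a + b + 1)) = P at *
    generalize (1 + u) ^ (a + b + 1) = Q at *
    generalize y ^ (b + 1 - 1) = R1
    generalize y ^ (a - 1) = R2
    generalize u ^ (a - 1) = R3
    generalize ((1:ℝ) / 2) ^ (b + 1) = R4
    generalize ((1:ℝ) / 2) ^ a = R5
    generalize rexp (-(1 / 2 * y)) = R6
    generalize rexp (-(1 / 2 * (u * y))) = R7
    field_simp
    linear_combination (-R1 * R2 * R3 * R4 * R5 * R6 * R7) * x5
  have hae : ∀ᵐ y : ℝ, y ≠ 0 := by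
    simp [ae_iff]
  rw [lintegral_congr_ae (hae.mono key), lintegral_const_mul _ (measurable_gammaPDF' _ _),
    lintegral_gammaPDF_eq_one (by linarith) (by linarith), mul_one]

lemma bp_law {a b : ℝ} (ha : 0 < a) (hb : 0 < b) (w : ℝ → ENNReal) (hw : Measurable w) :
    ∫⁻ y, ∫⁻ x, w (x / y) ∂(gammaMeasure a (1 / 2)) ∂(gammaMeasure (b + 1) (1 / 2)) =
      ∫⁻ u in Set.Ioi 0, w u * ENNReal.ofReal (bpC a b * bpK a b u) := by
  have hga := measurable_gammaPDF' a (1 / 2)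
  have hgb := measurable_gammaPDF' (b + 1) (1 / 2)
  have hae : ∀ᵐ y : ℝ, y ≠ 0 := by simp [ae_iff]
  have s1 : ∀ y, ∫⁻ x, w (x / y) ∂(gammaMeasure a (1 / 2)) =
      ∫⁻ x, gammaPDF a (1 / 2) x * w (x / y) := fun y => by
    rw [gammaMeasure, lintegral_withDensity_eq_lintegral_mul _ hga (by fun_prop)]
    rfl
  simp_rw [s1]
  have hm : Measurable fun y : ℝ => ∫⁻ x, gammaPDF a (1 / 2) x * w (x / y) := by
    apply Measurable.lintegral_prod_right'
      (f := fun p : ℝ × ℝ => gammaPDF a (1 / 2) p.2 * w (p.2 / p.1))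
    fun_prop
  rw [gammaMeasure, lintegral_withDensity_eq_lintegral_mul _ hgb hm]
  have s2 : ∀ y : ℝ, y ≠ 0 →
      (gammaPDF (b + 1) (1 / 2) * fun y => ∫⁻ x, gammaPDF a (1 / 2) x * w (x / y)) y =
      ∫⁻ u, w u * (gammaPDF (b + 1) (1 / 2) y *
        (ENNReal.ofReal y * gammaPDF a (1 / 2) (u * y))) := by
    intro y hy
    simp only [Pi.mul_apply]
    rcases lt_or_gt_of_ne hy with hy | hy
    · simp [gammaPDF_of_neg hy]
    rw [lintegral_scale _ (by fun_prop) hy, ← lintegral_const_mul _ (by fun_prop),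
      ← lintegral_const_mul _ (by fun_prop)]
    refine lintegral_congr fun u => ?_
    rw [mul_div_cancel_right₀ _ hy.ne']
    ring
  rw [lintegral_congr_ae (hae.mono s2), lintegral_lintegral_swap
    (Measurable.aemeasurable (by unfold Function.uncurry; fun_prop)),
    ← lintegral_indicator measurableSet_Ioi]
  refine lintegral_congr_ae (hae.mono fun u hu => ?_)
  simp only
  rw [lintegral_const_mul _ (by fun_prop)]
  rcases lt_or_gt_of_ne hu with hu | hu
  · rw [Set.indicator_of_notMem (by simpa using hu.le)]
    have : ∀ y, gammaPDF (b + 1) (1 / 2) y *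
        (ENNReal.ofReal y * gammaPDF a (1 / 2) (u * y)) = 0 := by
      intro y
      rcases le_or_gt y 0 with hy | hy
      · simp [ENNReal.ofReal_of_nonpos hy]
      · simp [gammaPDF_of_neg (mul_neg_of_neg_of_pos hu hy)]
    simp_rw [this]
    rw [lintegral_zero, mul_zero]
  · rw [Set.indicator_of_mem (by simpa using hu), bp_inner ha hb hu]

lemma gamma_bias {b : ℝ} (hb : 0 < b) (g : ℝ → ENNReal) (hg : Measurable g) :
    ∫⁻ y, ENNReal.ofReal y * g y ∂(gammaMeasure b (1 / 2)) =
      ENNReal.ofReal (2 * b) * ∫⁻ y, g y ∂(gammaMeasure (b + 1) (1 / 2)) := by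
  have hgb := measurable_gammaPDF' b (1 / 2)
  have hgb' := measurable_gammaPDF' (b + 1) (1 / 2)
  have hae : ∀ᵐ y : ℝ, y ≠ 0 := by simp [ae_iff]
  rw [gammaMeasure, gammaMeasure, lintegral_withDensity_eq_lintegral_mul _ hgb (by fun_prop),
    lintegral_withDensity_eq_lintegral_mul _ hgb' hg,
    ← lintegral_const_mul _ (by fun_prop)]
  refine lintegral_congr_ae (hae.mono fun y hy => ?_)
  simp only [Pi.mul_apply]
  rw [← mul_assoc, ← mul_assoc]
  congr 1
  rcases lt_or_gt_of_ne hy with hy | hy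
  · simp [gammaPDF_of_neg hy]
  have g1 := Gamma_pos_of_pos hb
  rw [gammaPDF_of_nonneg hy.le, gammaPDF_of_nonneg hy.le,
    ← ENNReal.ofReal_mul (by positivity), ← ENNReal.ofReal_mul (by positivity)]
  congr 1
  rw [Real.Gamma_add_one hb.ne', Real.rpow_add_one (by norm_num : (1 / 2 : ℝ) ≠ 0),
    show y ^ (b + 1 - 1) = y ^ (b - 1) * y by rw [← Real.rpow_add_one hy.ne']; ring_nf]
  field_simp

lemma gamma_pos_ae (b : ℝ) : ∀ᵐ y ∂(gammaMeasure b (1 / 2)), 0 < y := by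
  rw [gammaMeasure, ae_withDensity_iff (measurable_gammaPDF' _ _)]
  have hae : ∀ᵐ y : ℝ, y ≠ 0 := by simp [ae_iff]
  filter_upwards [hae] with y hy h
  by_contra hn
  exact h (gammaPDF_of_neg (lt_of_le_of_ne (not_lt.1 hn) hy))

lemma indep_lint {Ω : Type*} [MeasureSpace Ω] [IsProbabilityMeasure (ℙ : Measure Ω)]
    {X Y : Ω → ℝ} (hX : Measurable X) (hY : Measurable Y) (hXY : IndepFun X Y ℙ)
    {μ ν : Measure ℝ} (hμ : Measure.map X ℙ = μ) (hν : Measure.map Y ℙ = ν)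
    (F : ℝ → ℝ → ENNReal) (hF : Measurable (Function.uncurry F)) :
    ∫⁻ ω, F (X ω) (Y ω) ∂ℙ = ∫⁻ y, ∫⁻ x, F x y ∂μ ∂ν := by
  have h := (indepFun_iff_map_prod_eq_prod_map_map hX.aemeasurable hY.aemeasurable).1 hXY
  have : IsProbabilityMeasure μ := hμ ▸ Measure.isProbabilityMeasure_map hX.aemeasurable
  have : IsProbabilityMeasure ν := hν ▸ Measure.isProbabilityMeasure_map hY.aemeasurable
  rw [hμ, hν] at h
  have e := lintegral_map (μ := (ℙ : Measure Ω)) hF (hX.prodMk hY)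
  rw [h, lintegral_prod_symm _ hF.aemeasurable] at e
  exact e.symm

theorem stmt_6
    {Ω : Type*} [MeasureSpace Ω] [IsProbabilityMeasure (ℙ : Measure Ω)]
    (D N : ℕ) (hD : 2 ≤ D) (hN : 1 ≤ N) (x : ℝ) (hx : (D : ℝ) ≤ x)
    (X Y C E : Ω → ℝ)
    (hX : Measurable X) (hY : Measurable Y) (hC : Measurable C) (hE : Measurable E)
    (hXlaw : Measure.map X ℙ = gammaMeasure (D / 2) (1 / 2))
    (hYlaw : Measure.map Y ℙ = gammaMeasure (N / 2) (1 / 2))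
    (hClaw : Measure.map C ℙ = gammaMeasure (D / 2) (1 / 2))
    (hElaw : Measure.map E ℙ = gammaMeasure ((N + 2) / 2) (1 / 2))
    (hXY : IndepFun X Y ℙ) (hCE : IndepFun C E ℙ) :
    (∫ ω, max (X ω - x * Y ω / N) 0 ∂ℙ) / D ≤
      (1 + 2 * x / (N * D)) *
        (ℙ {ω | (C ω / D) / (E ω / (N + 2)) ≥ (N + 2) * x / (N * D)}).toReal := by
  have hDR : (2 : ℝ) ≤ D := by exact_mod_cast hD
  have hNR : (1 : ℝ) ≤ N := by exact_mod_cast hN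
  have hN0 : (0 : ℝ) < N := by linarith
  have hD0 : (0 : ℝ) < D := by linarith
  obtain ⟨a, haD⟩ : ∃ a : ℝ, a = D / 2 := ⟨_, rfl⟩
  obtain ⟨b, hbN⟩ : ∃ b : ℝ, b = N / 2 := ⟨_, rfl⟩
  obtain ⟨c, hcx⟩ : ∃ c : ℝ, c = x / N := ⟨_, rfl⟩
  have ha : 1 ≤ a := by linarith
  have ha0 : 0 < a := by linarith
  have hb : 0 < b := by linarith
  have hac : a / b ≤ c := by
    rw [haD, hbN, hcx, div_div_div_cancel_right₀ (by norm_num)]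
    gcongr
  have hc0 : 0 < c := lt_of_lt_of_le (by positivity) hac
  rw [show ((N : ℝ) + 2) / 2 = b + 1 by rw [hbN]; ring] at hElaw
  rw [← haD] at hXlaw hClaw
  rw [← hbN] at hYlaw
  obtain ⟨hAint, hmain⟩ := bp_main ha hb hac
  have hKint := bpK_int ha0 hb hc0
  have hCpos := bpC_pos ha0 hb
  set A := ∫ u in Set.Ioi c, (u - c) * bpK a b u with hA
  set B := ∫ u in Set.Ioi c, bpK a b u with hB
  have hKm := bpK_meas a b
  -- left side
  have hL : ∫ ω, max (X ω - x * Y ω / N) 0 ∂ℙ = 2 * b * (bpC a b * A) := by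
    rw [integral_eq_lintegral_of_nonneg_ae (f := fun ω => max (X ω - x * Y ω / N) 0)
      (Filter.Eventually.of_forall fun _ => le_max_right _ _)
      (Measurable.aestronglyMeasurable (by fun_prop))]
    have h1 := indep_lint hX hY hXY hXlaw hYlaw
      (fun s t => ENNReal.ofReal (max (s - x * t / N) 0)) (by unfold Function.uncurry; fun_prop)
    rw [h1]
    have h2 : ∫⁻ y, ∫⁻ s, ENNReal.ofReal (max (s - x * y / N) 0) ∂(gammaMeasure a (1 / 2))
          ∂(gammaMeasure b (1 / 2)) =
        ∫⁻ y, ENNReal.ofReal y * ∫⁻ s, ENNReal.ofReal (s / y - c) ∂(gammaMeasure a (1 / 2))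
          ∂(gammaMeasure b (1 / 2)) := by
      refine lintegral_congr_ae ((gamma_pos_ae b).mono fun y hy => ?_)
      simp only
      rw [← lintegral_const_mul _ (by fun_prop)]
      refine lintegral_congr fun s => ?_
      rw [← ENNReal.ofReal_mul hy.le, ENNReal.ofReal_max, ENNReal.ofReal_zero, max_eq_left zero_le]
      congr 1
      rw [hcx]; field_simp
    have : IsProbabilityMeasure (gammaMeasure a (1 / 2)) :=
      isProbabilityMeasure_gammaMeasure ha0 (by norm_num)
    rw [h2, gamma_bias hb, bp_law ha0 hb (fun u => ENNReal.ofReal (u - c)) (by fun_prop)]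
    · rw [ENNReal.toReal_mul, ENNReal.toReal_ofReal (by positivity)]
      congr 1
      rw [hA, ← integral_const_mul, integral_eq_lintegral_of_nonneg_ae]
      · congr 1
        rw [← lintegral_indicator measurableSet_Ioi, ← lintegral_indicator measurableSet_Ioi]
        refine lintegral_congr fun u => ?_
        by_cases h : c < u
        · rw [Set.indicator_of_mem (by exact hc0.trans h), Set.indicator_of_mem (by exact h),
            ← ENNReal.ofReal_mul (by linarith)]
          congr 1; ring
        · rw [Set.indicator_of_notMem (s := Set.Ioi c) (by exact h)]
          simp [Set.indicator_apply, ENNReal.ofReal_of_nonpos (show u - c ≤ 0 by linarith)]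
      · filter_upwards [ae_restrict_mem measurableSet_Ioi] with u hu
        have hu : c < u := hu
        have := bpK_nonneg (a := a) (b := b) (hc0.trans hu)
        have : 0 ≤ u - c := by linarith
        simp only [Pi.zero_apply]
        positivity
      · exact (hAint.const_mul _).aestronglyMeasurable
    · apply Measurable.lintegral_prod_right'
        (f := fun p : ℝ × ℝ => ENNReal.ofReal (p.2 / p.1 - c))
      fun_prop
  -- right side
  have hR : (ℙ {ω | (C ω / D) / (E ω / (N + 2)) ≥ (N + 2) * x / (N * D)}).toReal =
      bpC a b * B := by
    have hset : {ω | (C ω / D) / (E ω / (N + 2)) ≥ (N + 2) * x / (N * D)} =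
        {ω | c ≤ C ω / E ω} := by
      ext ω
      simp only [Set.mem_ofPred_eq, ge_iff_le]
      have e1 : (C ω / D) / (E ω / (N + 2)) = ((N + 2) / D) * (C ω / E ω) := by
        rw [div_div_div_eq]; ring
      have e2 : (N + 2) * x / (N * D) = ((N + 2) / D) * c := by
        rw [hcx]; field_simp
      rw [e1, e2]
      exact mul_le_mul_iff_right₀ (by positivity)
    have hms : MeasurableSet {ω | c ≤ C ω / E ω} := measurableSet_le (by fun_prop) (by fun_prop)
    have hwm : Measurable ((Set.Ici c).indicator (fun _ => (1 : ENNReal))) :=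
      measurable_const.indicator measurableSet_Ici
    have h1 := indep_lint hC hE hCE hClaw hElaw
      (fun s t => (Set.Ici c).indicator (fun _ => (1 : ENNReal)) (s / t))
      (by unfold Function.uncurry; exact hwm.comp (by fun_prop))
    rw [bp_law ha0 hb _ hwm] at h1
    have h0 : ∫⁻ ω, (Set.Ici c).indicator (fun _ => (1 : ENNReal)) (C ω / E ω) ∂ℙ =
        ℙ {ω | c ≤ C ω / E ω} := by
      rw [← lintegral_indicator_one hms]
      rfl
    rw [hset, ← h0, h1, hB, ← integral_const_mul, integral_eq_lintegral_of_nonneg_ae]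
    · congr 1
      rw [← lintegral_indicator measurableSet_Ioi, ← lintegral_indicator measurableSet_Ioi]
      have hae : ∀ᵐ y : ℝ, y ≠ c := by simp [ae_iff]
      refine lintegral_congr_ae (hae.mono fun u hu => ?_)
      by_cases h : c < u
      · simp [Set.indicator_apply, h, h.le, hc0.trans h]
      · have : ¬ c ≤ u := fun h' => h (lt_of_le_of_ne h' (Ne.symm hu))
        simp [Set.indicator_apply, h, this]
    · filter_upwards [ae_restrict_mem measurableSet_Ioi] with u hu
      have := bpK_nonneg (a := a) (b := b) (hc0.trans hu)
      simp only [Pi.zero_apply]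
      positivity
    · exact (hKint.const_mul _).aestronglyMeasurable
  rw [hL, hR, div_le_iff₀ hD0]
  have e3 : (1 + 2 * x / (N * D)) * (bpC a b * B) * D = 2 * (bpC a b * ((a + c) * B)) := by
    rw [haD, hcx]; field_simp
  rw [e3]
  have := mul_le_mul_of_nonneg_left hmain hCpos.le
  linarith
end

section
/- Let D ≥ 2 and N ≥ 3 be integers and x ≥ N/(N-2). Then Fish(D,N,x) ≤ (1 + 2x/N)·P(F_{D,N} ≥ x), where Fish(D,N,x) = E[(F_{D,N} - x)₊]/E[F_{D,N}] and F_{D,N} is a Fisher random variable with D and N degrees of freedom. -/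
open MeasureTheory ProbabilityTheory Real

/-- density of the ratio of two independent gamma variables -/
noncomputable def ratioPDF (a b t : ℝ) : ℝ :=
  if 0 ≤ t then Gamma (a + b) / (Gamma a * Gamma b) * (t ^ (a - 1) * (1 + t) ^ (-(a + b))) else 0

lemma ratioPDF_nonneg {a b : ℝ} (ha : 0 < a) (hb : 0 < b) (t : ℝ) : 0 ≤ ratioPDF a b t := by
  unfold ratioPDF
  split_ifs
  · have := Gamma_pos_of_pos ha
    have := Gamma_pos_of_pos hb
    have := Gamma_pos_of_pos (add_pos ha hb)
    positivity
  · exact le_rfl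

lemma measurable_ratioPDF (a b : ℝ) : Measurable (ratioPDF a b) := by
  unfold ratioPDF
  refine Measurable.ite measurableSet_Ici ?_ measurable_const
  fun_prop

lemma pdf_identity {a b r t y : ℝ} (ha : 0 < a) (hb : 0 < b) (hr : 0 < r) (ht : 0 ≤ t) (hy : 0 < y) :
    gammaPDF b r y * (ENNReal.ofReal y * gammaPDF a r (t * y)) =
      ENNReal.ofReal (ratioPDF a b t) * gammaPDF (a + b) (r * (1 + t)) y := by
  have h1 := Gamma_pos_of_pos ha
  have h2 := Gamma_pos_of_pos hb
  have h3 := Gamma_pos_of_pos (add_pos ha hb)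
  have hty : 0 ≤ t * y := by positivity
  rw [gammaPDF_of_nonneg hy.le, gammaPDF_of_nonneg hty, gammaPDF_of_nonneg hy.le,
    ← ENNReal.ofReal_mul hy.le, ← ENNReal.ofReal_mul (by positivity),
    ← ENNReal.ofReal_mul (ratioPDF_nonneg ha hb t)]
  congr 1
  rw [ratioPDF, if_pos ht, mul_rpow ht hy.le, mul_rpow hr.le (by positivity),
    rpow_neg (by positivity), rpow_add hr, show a + b - 1 = (a - 1) + (b - 1) + 1 by ring,
    rpow_add hy, rpow_add hy, rpow_one,
    show -(r * (1 + t) * y) = -(r * y) + -(r * (t * y)) by ring, exp_add]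
  have h4 : (1 + t) ^ (a + b) ≠ 0 := by positivity
  field_simp

lemma lintegral_ratio {a b r : ℝ} (ha : 0 < a) (hb : 0 < b) (hr : 0 < r) (g : ℝ → ENNReal)
    (hg : Measurable g) :
    ∫⁻ y, ∫⁻ x, g (x / y) ∂gammaMeasure a r ∂gammaMeasure b r
      = ∫⁻ t, ENNReal.ofReal (ratioPDF a b t) * g t := by
  have mpdf : ∀ a r, Measurable (gammaPDF a r) := fun a r =>
    (measurable_gammaPDFReal a r).ennreal_ofReal
  have mH := (measurable_ratioPDF a b).ennreal_ofReal
  have : IsProbabilityMeasure (gammaMeasure a r) := isProbabilityMeasure_gammaMeasure ha hr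
  have mG : Measurable (fun y => ∫⁻ x, g (x / y) ∂gammaMeasure a r) := by
    apply Measurable.lintegral_prod_right' (f := fun p : ℝ × ℝ => g (p.2 / p.1))
    fun_prop
  have mJ : Measurable (fun p : ℝ × ℝ => gammaPDF (a + b) (r * (1 + p.2)) p.1) := by
    unfold gammaPDF gammaPDFReal
    refine Measurable.ennreal_ofReal (Measurable.ite ?_ ?_ measurable_const)
    · exact measurableSet_le measurable_const measurable_fst
    · fun_prop
  conv_lhs => rw [gammaMeasure.eq_1 b r]
  rw [lintegral_withDensity_eq_lintegral_mul _ (mpdf b r) mG]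
  have step : ∀ᵐ y : ℝ, (gammaPDF b r * fun y => ∫⁻ x, g (x / y) ∂gammaMeasure a r) y =
      ∫⁻ t, ENNReal.ofReal (ratioPDF a b t) * g t * gammaPDF (a + b) (r * (1 + t)) y := by
    have h0 : ∀ᵐ y : ℝ, y ≠ 0 := by simp [ae_iff]
    filter_upwards [h0] with y hy0
    rcases lt_or_gt_of_ne hy0 with hy | hy
    · simp [gammaPDF_of_neg hy]
    · simp only [Pi.mul_apply]
      have mgy : Measurable fun x => g (x / y) := by fun_prop
      rw [gammaMeasure, lintegral_withDensity_eq_lintegral_mul _ (mpdf a r) mgy]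
      have mm : Measurable fun t => (gammaPDF a r * fun x => g (x / y)) (t * y) :=
        ((mpdf a r).mul mgy).comp (measurable_id.mul_const y)
      conv_lhs => rw [← Real.smul_map_volume_mul_right hy.ne']
      rw [lintegral_smul_measure, lintegral_map ((mpdf a r).mul mgy) (by fun_prop), abs_of_pos hy,
        smul_eq_mul, ← lintegral_const_mul _ mm,
        ← lintegral_const_mul _ (mm.const_mul _)]
      refine lintegral_congr fun t => ?_
      simp only [Pi.mul_apply]
      rw [mul_div_assoc, div_self hy.ne', mul_one]
      rcases lt_or_ge t 0 with ht | ht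
      · rw [gammaPDF_of_neg (mul_neg_of_neg_of_pos ht hy), ratioPDF, if_neg (not_le.mpr ht)]
        simp
      · have := pdf_identity ha hb hr ht hy
        calc _ = gammaPDF b r y * (ENNReal.ofReal y * gammaPDF a r (t * y)) * g t := by ring
          _ = _ := by rw [this]; ring
  rw [lintegral_congr_ae step, lintegral_lintegral_swap]
  · refine lintegral_congr fun t => ?_
    rcases lt_or_ge t 0 with ht | ht
    · simp [ratioPDF, if_neg (not_le.mpr ht)]
    · rw [lintegral_const_mul _ (mpdf _ _), lintegral_gammaPDF_eq_one (by positivity) (by positivity),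
        mul_one]
  · apply Measurable.aemeasurable
    exact ((mH.comp measurable_snd).mul (hg.comp measurable_snd)).mul mJ

lemma map_ratio {Ω : Type*} [MeasurableSpace Ω] {P : Measure Ω} [IsProbabilityMeasure P]
    {a b r : ℝ} (ha : 0 < a) (hb : 0 < b) (hr : 0 < r) {X Y : Ω → ℝ} (hX : Measurable X)
    (hY : Measurable Y) (hXlaw : P.map X = gammaMeasure a r) (hYlaw : P.map Y = gammaMeasure b r)
    (hXY : IndepFun X Y P) :
    P.map (fun ω => X ω / Y ω) = volume.withDensity (fun t => ENNReal.ofReal (ratioPDF a b t)) := by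
  have i1 : IsProbabilityMeasure (gammaMeasure a r) := isProbabilityMeasure_gammaMeasure ha hr
  have i2 : IsProbabilityMeasure (gammaMeasure b r) := isProbabilityMeasure_gammaMeasure hb hr
  have hp := (indepFun_iff_map_prod_eq_prod_map_map hY.aemeasurable hX.aemeasurable).mp hXY.symm
  rw [hXlaw, hYlaw] at hp
  ext s hs
  have m1 : Measurable (s.indicator (1 : ℝ → ENNReal)) := measurable_one.indicator hs
  have m2 : Measurable (fun p : ℝ × ℝ => s.indicator (1 : ℝ → ENNReal) (p.2 / p.1)) :=
    m1.comp (by fun_prop)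
  rw [← lintegral_indicator_one hs, ← lintegral_indicator_one hs,
    lintegral_withDensity_eq_lintegral_mul _ (measurable_ratioPDF a b).ennreal_ofReal m1]
  rw [lintegral_map m1 (by fun_prop)]
  simp only [Pi.mul_apply]
  rw [← lintegral_ratio ha hb hr _ m1, ← lintegral_prod _ m2.aemeasurable, ← hp,
    lintegral_map m2 (by fun_prop)]

section helpers
open Filter Set Topology

lemma pow_bound {p q t : ℝ} (hp : 0 ≤ p) (ht : 0 ≤ t) : t ^ p * (1 + t) ^ q ≤ (t + 1) ^ (p + q) := by
  rw [add_comm t 1, rpow_add (by positivity)]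
  gcongr
  linarith

lemma pow_tendsto {p q : ℝ} (hp : 0 ≤ p) (hq : p + q < 0) :
    Tendsto (fun t : ℝ => t ^ p * (1 + t) ^ q) atTop (𝓝 0) := by
  have h1 : Tendsto (fun t : ℝ => (t + 1) ^ (p + q)) atTop (𝓝 0) := by
    have := (tendsto_rpow_neg_atTop (y := -(p + q)) (by linarith)).comp
      (tendsto_atTop_add_const_right atTop (1 : ℝ) tendsto_id)
    simpa [Function.comp_def] using this
  refine tendsto_of_tendsto_of_tendsto_of_le_of_le' tendsto_const_nhds h1 ?_ ?_
  · filter_upwards [eventually_ge_atTop 0] with t ht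
    positivity
  · filter_upwards [eventually_ge_atTop 0] with t ht
    exact pow_bound hp ht

lemma pow_integrable {p q : ℝ} (hp : 0 ≤ p) (hq : p + q < -1) :
    IntegrableOn (fun t : ℝ => t ^ p * (1 + t) ^ q) (Ioi 0) := by
  refine Integrable.mono' (integrableOn_add_rpow_Ioi_of_lt (m := 1) (c := 0) hq (by norm_num)) ?_ ?_
  · apply Measurable.aestronglyMeasurable
    fun_prop
  · refine (ae_restrict_iff' measurableSet_Ioi).mpr (ae_of_all _ fun t ht => ?_)
    have ht : 0 < t := ht
    rw [norm_of_nonneg (by positivity)]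
    exact pow_bound hp ht.le

lemma pow_deriv {p q t : ℝ} (ht : 0 < t) :
    HasDerivAt (fun t : ℝ => t ^ p * (1 + t) ^ q)
      (t ^ (p - 1) * (1 + t) ^ (q - 1) * (p * (1 + t) + q * t)) t := by
  have h1 := Real.hasDerivAt_rpow_const (x := t) (p := p) (Or.inl ht.ne')
  have h2 := ((hasDerivAt_id t).const_add 1).rpow_const (p := q) (Or.inl (by simp; positivity))
  convert! h1.mul h2 using 1
  simp only [id]
  have e1 : t ^ p = t ^ (p - 1) * t := by rw [← rpow_add_one ht.ne']; ring_nf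
  have e2 : (1 + t) ^ q = (1 + t) ^ (q - 1) * (1 + t) := by
    rw [← rpow_add_one (by positivity)]; ring_nf
  rw [e1, e2]
  ring

/-- unnormalised density -/
noncomputable def kern (a b t : ℝ) : ℝ := t ^ (a - 1) * (1 + t) ^ (-(a + b))

lemma kern_int {a b : ℝ} (ha : 1 ≤ a) (hb : 1 < b) : IntegrableOn (kern a b) (Ioi 0) :=
  pow_integrable (by linarith) (by linarith)

lemma kern_nonneg {a b t : ℝ} (ht : 0 < t) : 0 ≤ kern a b t := by
  unfold kern; positivity

lemma kern_int' {a b : ℝ} (ha : 1 ≤ a) (hb : 1 < b) :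
    IntegrableOn (fun t => t * kern a b t) (Ioi 0) := by
  refine (pow_integrable (p := a) (q := -(a + b)) (by linarith) (by linarith)).congr_fun ?_
    measurableSet_Ioi
  intro t ht
  have ht : 0 < t := ht
  simp only [kern]
  rw [← mul_assoc, mul_comm t, ← rpow_add_one ht.ne']
  ring_nf

lemma stein {a b u : ℝ} (ha : 1 ≤ a) (hb : 1 < b) (hu : 0 ≤ u) :
    (b - 1) * (∫ t in Ioi u, t * kern a b t) - a * (∫ t in Ioi u, kern a b t)
      = u ^ a * (1 + u) ^ (1 - a - b) := by
  have hs : Ioi u ⊆ Ioi 0 := Ioi_subset_Ioi hu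
  have i1 := (kern_int ha hb).mono_set hs
  have i2 := (kern_int' ha hb).mono_set hs
  have key := integral_Ioi_of_hasDerivAt_of_tendsto (a := u) (m := 0)
    (f := fun t : ℝ => t ^ a * (1 + t) ^ (1 - a - b))
    (f' := fun t => a * kern a b t - (b - 1) * (t * kern a b t)) ?_ ?_
    ((i1.const_mul a).sub (i2.const_mul (b - 1))) (pow_tendsto (by linarith) (by linarith))
  · rw [integral_sub (i1.const_mul a) (i2.const_mul (b - 1)), integral_const_mul,
      integral_const_mul] at key
    linarith
  · apply ContinuousAt.continuousWithinAt
    refine ContinuousAt.mul (continuousAt_rpow_const _ _ (Or.inr (by linarith))) ?_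
    refine ContinuousAt.rpow_const (by fun_prop) (Or.inl (by positivity))
  · intro t ht
    have ht : 0 < t := lt_of_le_of_lt hu ht
    convert! pow_deriv (p := a) (q := 1 - a - b) ht using 1
    simp only [kern]
    rw [show 1 - a - b - 1 = -(a + b) by ring]
    ring

lemma hazard {a b u : ℝ} (ha : 1 ≤ a) (hb : 1 < b) (hu : 0 < u) :
    u ^ (a - 1) * (1 + u) ^ (1 - a - b) ≤ b * ∫ t in Ioi u, kern a b t := by
  have hs : Ioi u ⊆ Ioi 0 := Ioi_subset_Ioi hu.le
  have i1 := (kern_int ha hb).mono_set hs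
  have i2 : IntegrableOn (fun t => t⁻¹ * kern a b t) (Ioi u) := by
    refine Integrable.mono' (i1.const_mul u⁻¹) ?_ ?_
    · exact (measurable_inv.aestronglyMeasurable).mul i1.aestronglyMeasurable
    · refine (ae_restrict_iff' measurableSet_Ioi).mpr (ae_of_all _ fun t ht => ?_)
      have ht' : u < t := ht
      have h0 : 0 < t := hu.trans ht'
      have hk := kern_nonneg (a := a) (b := b) h0
      rw [norm_of_nonneg (by positivity)]
      gcongr
  have key := integral_Ioi_of_hasDerivAt_of_tendsto' (a := u) (m := 0)
    (f := fun t : ℝ => t ^ (a - 1) * (1 + t) ^ (1 - a - b))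
    (f' := fun t => (a - 1) * (t⁻¹ * kern a b t) - b * kern a b t) ?_
    ((i2.const_mul (a - 1)).sub (i1.const_mul b)) (pow_tendsto (by linarith) (by linarith))
  · rw [integral_sub (i2.const_mul (a - 1)) (i1.const_mul b), integral_const_mul,
      integral_const_mul] at key
    have : 0 ≤ ∫ t in Ioi u, t⁻¹ * kern a b t := by
      refine setIntegral_nonneg measurableSet_Ioi fun t ht => ?_
      have h0 : 0 < t := hu.trans ht
      have hk := kern_nonneg (a := a) (b := b) h0
      positivity
    have := mul_nonneg (sub_nonneg.mpr ha) this
    linarith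
  · intro t ht
    have ht : 0 < t := lt_of_lt_of_le hu ht
    convert! pow_deriv (p := a - 1) (q := 1 - a - b) ht using 1
    simp only [kern]
    rw [show 1 - a - b - 1 = -(a + b) by ring, rpow_sub_one ht.ne' (a - 1)]
    field_simp
    ring

/-- the one dimensional inequality -/
lemma kern_main {a b u : ℝ} (ha : 1 ≤ a) (hb : 1 < b) (hu : 0 < u) :
    (b - 1) * (∫ t in Ioi u, (t - u) * kern a b t) ≤ (u + a) * ∫ t in Ioi u, kern a b t := by
  have hs : Ioi u ⊆ Ioi 0 := Ioi_subset_Ioi hu.le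
  have i1 := (kern_int ha hb).mono_set hs
  have i2 := (kern_int' ha hb).mono_set hs
  have e : ∫ t in Ioi u, (t - u) * kern a b t =
      (∫ t in Ioi u, t * kern a b t) - u * ∫ t in Ioi u, kern a b t := by
    simp_rw [sub_mul]
    rw [integral_sub i2 (i1.const_mul u), integral_const_mul]
  have h1 := stein ha hb hu.le
  have h2 := mul_le_mul_of_nonneg_left (hazard ha hb hu) hu.le
  have e1 : u ^ a = u * u ^ (a - 1) := by rw [mul_comm, ← rpow_add_one hu.ne']; ring_nf
  rw [e]
  rw [e1] at h1
  nlinarith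

lemma integral_ratio {Ω : Type*} [MeasurableSpace Ω] {P : Measure Ω} [IsProbabilityMeasure P]
    {a b r : ℝ} (ha : 0 < a) (hb : 0 < b) (hr : 0 < r) {X Y : Ω → ℝ} (hX : Measurable X)
    (hY : Measurable Y) (hXlaw : P.map X = gammaMeasure a r) (hYlaw : P.map Y = gammaMeasure b r)
    (hXY : IndepFun X Y P) (φ : ℝ → ℝ) (hφ : Measurable φ) :
    ∫ ω, φ (X ω / Y ω) ∂P =
      Gamma (a + b) / (Gamma a * Gamma b) * ∫ t in Ioi 0, φ t * kern a b t := by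
  rw [← integral_map (φ := fun ω => X ω / Y ω) (hX.div hY).aemeasurable
      hφ.aestronglyMeasurable, map_ratio ha hb hr hX hY hXlaw hYlaw hXY,
    integral_withDensity_eq_integral_toReal_smul (measurable_ratioPDF a b).ennreal_ofReal
      (ae_of_all _ fun t => ENNReal.ofReal_lt_top),
    ← setIntegral_eq_integral_of_forall_compl_eq_zero (s := Ici 0), integral_Ici_eq_integral_Ioi,
    ← integral_const_mul]
  · refine setIntegral_congr_fun measurableSet_Ioi fun t ht => ?_
    have ht : 0 < t := ht
    simp only [ENNReal.toReal_ofReal (ratioPDF_nonneg ha hb t), smul_eq_mul]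
    rw [ratioPDF, if_pos ht.le, kern]
    ring
  · intro t ht
    have ht0 : ¬ (0 ≤ t) := fun h => ht h
    rw [ratioPDF, if_neg ht0]
    simp

end helpers

open Set

/-- Let `D ≥ 2` and `N ≥ 3` be integers and `x ≥ N/(N-2)`.  Then
`Fish(D,N,x) ≤ (1 + 2x/N)·P(F_{D,N} ≥ x)`, where
`Fish(D,N,x) = E[(F_{D,N} - x)₊]/E[F_{D,N}]` and `F_{D,N} = (X/D)/(Y/N)` is a Fisher
random variable built from independent chi-squares `X ~ χ²(D)`, `Y ~ χ²(N)`
(a chi-square with `k` degrees of freedom being the Gamma distribution with shape `k/2`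
and rate `1/2`). -/
theorem stmt_8
    {Ω : Type*} [MeasureSpace Ω] [IsProbabilityMeasure (ℙ : Measure Ω)]
    (D N : ℕ) (hD : 2 ≤ D) (hN : 3 ≤ N) (x : ℝ) (hx : (N : ℝ) / (N - 2) ≤ x)
    (X Y : Ω → ℝ) (hX : Measurable X) (hY : Measurable Y)
    (hXlaw : Measure.map X ℙ = gammaMeasure (D / 2) (1 / 2))
    (hYlaw : Measure.map Y ℙ = gammaMeasure (N / 2) (1 / 2))
    (hXY : IndepFun X Y ℙ)
    (F : Ω → ℝ) (hF : ∀ ω, F ω = (X ω / D) / (Y ω / N)) :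
    (∫ ω, max (F ω - x) 0 ∂ℙ) / (∫ ω, F ω ∂ℙ) ≤
      (1 + 2 * x / N) * (ℙ {ω | F ω ≥ x}).toReal := by
  have hD' : (2 : ℝ) ≤ D := by exact_mod_cast hD
  have hN' : (3 : ℝ) ≤ N := by exact_mod_cast hN
  have hx0 : 0 < x := lt_of_lt_of_le (div_pos (by linarith) (by linarith)) hx
  have ha : (1 : ℝ) ≤ (D : ℝ) / 2 := by linarith
  have hb : (1 : ℝ) < (N : ℝ) / 2 := by linarith
  obtain ⟨a, haD⟩ : ∃ a : ℝ, a = (D : ℝ) / 2 := ⟨_, rfl⟩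
  obtain ⟨b, hbN⟩ : ∃ b : ℝ, b = (N : ℝ) / 2 := ⟨_, rfl⟩
  have eD : (D : ℝ) = 2 * a := by linarith
  have eN : (N : ℝ) = 2 * b := by linarith
  rw [← haD] at hXlaw ha
  rw [← hbN] at hYlaw hb
  have ha0 : 0 < a := by linarith
  have hb0 : 0 < b := by linarith
  have hb1 : 0 < b - 1 := by linarith
  have I := integral_ratio ha0 hb0 (by norm_num) hX hY hXlaw hYlaw hXY
  set K := Gamma (a + b) / (Gamma a * Gamma b) with hK
  have hK0 : 0 ≤ K := by
    have := Gamma_pos_of_pos ha0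
    have := Gamma_pos_of_pos hb0
    have := Gamma_pos_of_pos (add_pos ha0 hb0)
    positivity
  have hFR : ∀ ω, F ω = b / a * (X ω / Y ω) := by
    intro ω
    rw [hF, eD, eN]
    rcases eq_or_ne (Y ω) 0 with h | h
    · simp [h]
    · field_simp
  obtain ⟨u, hu⟩ : ∃ u : ℝ, u = a / b * x := ⟨_, rfl⟩
  have hu0 : 0 < u := by rw [hu]; positivity
  have hxu : x = b / a * u := by rw [hu]; field_simp
  have hs : Ioi u ⊆ Ioi 0 := Ioi_subset_Ioi hu0.le
  have J1 : 1 = K * ∫ t in Ioi 0, kern a b t := by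
    have := I (fun _ => 1) measurable_const
    simpa using this
  have J2 : ∫ ω, F ω ∂ℙ = b / (b - 1) := by
    have h := I (fun t => t) measurable_id
    have h2 := stein ha hb le_rfl
    rw [zero_rpow ha0.ne', zero_mul] at h2
    simp_rw [hFR]
    rw [integral_const_mul, h]
    have h3 : (b - 1) * (K * ∫ t in Ioi 0, t * kern a b t) = a := by
      calc _ = K * ((b - 1) * ∫ t in Ioi 0, t * kern a b t) := by ring
        _ = K * (a * ∫ t in Ioi 0, kern a b t) := by rw [sub_eq_zero.mp h2]
        _ = a * (K * ∫ t in Ioi 0, kern a b t) := by ring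
        _ = a := by rw [← J1, mul_one]
    rw [eq_div_iff hb1.ne', mul_assoc, mul_comm _ (b - 1), h3]
    field_simp
  have J3 : ∫ ω, max (F ω - x) 0 ∂ℙ = b / a * (K * ∫ t in Ioi u, (t - u) * kern a b t) := by
    have h := I (fun t => max (t - u) 0) (by fun_prop)
    have e : ∀ ω, max (F ω - x) 0 = b / a * max (X ω / Y ω - u) 0 := by
      intro ω
      rw [hFR, hxu, ← mul_sub, mul_max_of_nonneg _ _ (by positivity), mul_zero]
    simp_rw [e]
    rw [integral_const_mul, h]
    congr 2
    rw [← inter_eq_right.mpr hs, ← setIntegral_indicator measurableSet_Ioi]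
    refine setIntegral_congr_fun measurableSet_Ioi fun t ht => ?_
    by_cases htu : t ∈ Ioi u
    · have : u < t := htu
      simp only [indicator_of_mem htu]
      rw [max_eq_left (by linarith)]
    · have : t ≤ u := not_lt.mp htu
      simp only [indicator_of_notMem htu]
      rw [max_eq_right (by linarith), zero_mul]
  have J4 : (ℙ {ω | F ω ≥ x}).toReal = K * ∫ t in Ioi u, kern a b t := by
    have h := I ((Ici u).indicator 1) (measurable_one.indicator measurableSet_Ici)
    have e : {ω | F ω ≥ x} = (fun ω => X ω / Y ω) ⁻¹' (Ici u) := by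
      ext ω
      simp only [mem_ofPred_eq, mem_preimage, mem_Ici, ge_iff_le]
      rw [hFR, hxu]
      exact mul_le_mul_iff_right₀ (by positivity)
    have hm : MeasurableSet ((fun ω => X ω / Y ω) ⁻¹' (Ici u)) := (hX.div hY) measurableSet_Ici
    rw [e, ← measureReal_def, ← integral_indicator_one hm]
    have e2 : ∀ ω, ((fun ω => X ω / Y ω) ⁻¹' (Ici u)).indicator (1 : Ω → ℝ) ω
        = (Ici u).indicator 1 (X ω / Y ω) := fun ω => rfl
    simp_rw [e2]
    rw [h]
    congr 1
    have hs' : Ici u ⊆ Ioi 0 := Ici_subset_Ioi.mpr hu0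
    have e3 : ∫ t in Ioi u, kern a b t = ∫ t in Ioi 0, (Ici u).indicator (kern a b) t := by
      rw [setIntegral_indicator measurableSet_Ici, inter_eq_right.mpr hs',
        integral_Ici_eq_integral_Ioi]
    rw [e3]
    refine setIntegral_congr_fun measurableSet_Ioi fun t ht => ?_
    by_cases htu : t ∈ Ici u
    · simp [indicator_of_mem htu]
    · simp [indicator_of_notMem htu]
  rw [J2, J3, J4]
  have M := mul_le_mul_of_nonneg_left (kern_main ha hb hu0) hK0
  rw [eN, hxu]
  calc _ = (K * ((b - 1) * ∫ t in Ioi u, (t - u) * kern a b t)) / a := by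
        field_simp
    _ ≤ (K * ((u + a) * ∫ t in Ioi u, kern a b t)) / a := by gcongr
    _ = _ := by
        field_simp
        ring
end
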